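/- arXiv:1102.2207 — 2 statements merged into one kernel-verified Lean document; each statement's English description precedes it below -/
import Mathlib

section
/- The breakpoint α_{k+1} is exactly the value of α at which the weight of symbol n−k−1 merges with the common minimal weight: for every k ∈ {0,…,n−2}, (1 − α_{k+1})·p_{n−k−1} = (α_{k+1} + (1 − α_{k+1})·∑_{j=n−k}^{n} p_j)/(k+1). -/
/-- The breakpoints `α_k`: `α_0 = 0` and
`α_{k+1} = α_k + (1−α_k)·(p (n−k−1) − p (n−k)) / ((1/(k+1))·∑_{i=1}^{n−k−1} p i + p (n−k−1))`. -/
noncomputable def alphaB (n : ℕ) (p : ℕ → ℝ) : ℕ → ℝ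
  | 0 => 0
  | k + 1 =>
      alphaB n p k + (1 - alphaB n p k) * (p (n - k - 1) - p (n - k)) /
        ((1 / ((k : ℝ) + 1)) * (∑ i ∈ Finset.Icc 1 (n - k - 1), p i) + p (n - k - 1))

/-- The closed form `1 / (1 - α_k) = ∑_{i=1}^{n-k} p i + k * p (n-k)`, in product form. -/
theorem one_sub_alphaB_mul (n : ℕ) (p : ℕ → ℝ)
    (hpos : ∀ i, 1 ≤ i → i ≤ n → 0 < p i)
    (hsum : ∑ i ∈ Finset.Icc 1 n, p i = 1) (k : ℕ) (hk : k < n) :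
    (1 - alphaB n p k) * (∑ i ∈ Finset.Icc 1 (n - k), p i + k * p (n - k)) = 1 := by
  induction k with
  | zero => simp [alphaB, hsum]
  | succ k ih =>
    have ih := ih (by omega)
    obtain ⟨m, hm⟩ : ∃ m, n - k = m + 1 := ⟨n - k - 1, by omega⟩
    have hm' : n - (k + 1) = m := by omega
    rw [hm, Finset.sum_Icc_succ_top (by omega)] at ih
    simp only [alphaB, hm, hm', Nat.add_sub_cancel]
    have hq : 0 < p m := hpos m (by omega) (by omega)
    have hS : 0 ≤ ∑ i ∈ Finset.Icc 1 m, p i := Finset.sum_nonneg fun i hi =>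
      (hpos i (Finset.mem_Icc.1 hi).1 (by have := (Finset.mem_Icc.1 hi).2; omega)).le
    push_cast
    field_simp
    linear_combination ih

/-- The breakpoint `α_{k+1}` is exactly the value of `α` at which the
weight of symbol `n−k−1` merges with the common minimal weight: for every
`k ∈ {0,…,n−2}`,
`(1 − α_{k+1})·p (n−k−1) = (α_{k+1} + (1 − α_{k+1})·∑_{j=n−k}^{n} p j)/(k+1)`. -/
theorem breakpoint_merging_identity
    (n : ℕ) (hn : 2 ≤ n) (p : ℕ → ℝ)
    (hpos : ∀ i, 1 ≤ i → i ≤ n → 0 < p i)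
    (hmono : ∀ i j, 1 ≤ i → i ≤ j → j ≤ n → p j ≤ p i)
    (hsum : ∑ i ∈ Finset.Icc 1 n, p i = 1)
    (k : ℕ) (hk : k ≤ n - 2) :
    (1 - alphaB n p (k + 1)) * p (n - k - 1) =
      (alphaB n p (k + 1) +
        (1 - alphaB n p (k + 1)) * ∑ j ∈ Finset.Icc (n - k) n, p j) / ((k : ℝ) + 1) := by
  have h := one_sub_alphaB_mul n p hpos hsum (k + 1) (by omega)
  obtain ⟨m, hm⟩ : ∃ m, n - k = m + 1 := ⟨n - k - 1, by omega⟩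
  have hm' : n - (k + 1) = m := by omega
  have hsplit : ∑ i ∈ Finset.Icc 1 m, p i + ∑ j ∈ Finset.Icc (m + 1) n, p j = 1 := by
    rw [← hsum]
    simpa [← Finset.Ico_add_one_right_eq_Icc] using
      Finset.sum_Ico_consecutive p (show 1 ≤ m + 1 by omega) (show m + 1 ≤ n + 1 by omega)
  rw [hm'] at h
  push_cast at h
  rw [hm, Nat.add_sub_cancel, eq_div_iff (by positivity)]
  linear_combination h - (1 - alphaB n p (k + 1)) * hsplit
end

section
/- Optimal codelengths for the convex combination of exponential redundancy and average redundancy: let t > 0 and α ∈ [0,1], and suppose l† : {1,…,n} → ℝ satisfies D^{−l†(i)} = α·μ(i) + (1−α)·p_i for all i, where μ(i) = p_i^{t+1}·D^{t·l†(i)} / ∑_{j=1}^n p_j^{t+1}·D^{t·l†(j)}. Then ∑_{i=1}^n D^{−l†(i)} = 1, and for every l : {1,…,n} → ℝ with l_i ≥ 0 and ∑_{i=1}^n D^{−l_i} ≤ 1, one has (α/t)·log_D(∑_i p_i D^{t·(l†(i)+log_D p_i)}) + (1−α)·(∑_i p_i l†(i) − H_D(p)) ≤ (α/t)·log_D(∑_i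 p_i D^{t·(l_i+log_D p_i)}) + (1−α)·(∑_i p_i l_i − H_D(p)). -/
/-- **Jensen's inequality** for the exponential with base `b > 1`. -/
lemma sum_mul_le_logb_sum_mul_rpow {ι : Type*} [Fintype ι] {b : ℝ} (hb : 1 < b)
    {w : ι → ℝ} (hw : ∀ i, 0 ≤ w i) (hw1 : ∑ i, w i = 1) (x : ι → ℝ) :
    ∑ i, w i * x i ≤ Real.logb b (∑ i, w i * b ^ x i) := by
  have hb0 : 0 < b := by linarith
  have key : b ^ (∑ i, w i * x i) ≤ ∑ i, w i * b ^ x i := by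
    have h := convexOn_exp.map_sum_le (t := Finset.univ) (w := w)
      (p := fun i => Real.log b * x i) (fun i _ => hw i) hw1 (fun _ _ => Set.mem_univ _)
    simp only [smul_eq_mul] at h
    simp only [Real.rpow_def_of_pos hb0, Finset.mul_sum]
    refine le_trans (le_of_eq ?_) h
    congr 1
    exact Finset.sum_congr rfl fun i _ => by ring
  have hpos : 0 < b ^ (∑ i, w i * x i) := Real.rpow_pos_of_pos hb0 _
  rwa [Real.le_logb_iff_rpow_le hb (hpos.trans_le key)]


/-- Optimal codelengths for the convex combination of exponential
redundancy and average redundancy: if `t > 0`, `α ∈ [0,1]`, and `l†` satisfies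
`D^(−l†(i)) = α·μ(i) + (1−α)·p i` with
`μ(i) = (p i)^(t+1) · D^(t·l†(i)) / ∑ j, (p j)^(t+1) · D^(t·l†(j))`, then
`∑ i, D^(−l†(i)) = 1` and `l†` minimizes
`(α/t)·log_D(∑ i, p i · D^(t·(l i + log_D (p i)))) + (1−α)·(∑ i, p i · l i − H_D(p))`
over all nonnegative length vectors satisfying the Kraft inequality, where
`H_D(p) = −∑ i, p i · log_D (p i)`. -/
theorem optimal_codelengths_exponential_redundancy
    (n : ℕ) (hn : 2 ≤ n) (p : Fin n → ℝ) (hp : ∀ i, 0 < p i)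
    (hsum : ∑ i, p i = 1) (D : ℕ) (hD : 2 ≤ D)
    (t : ℝ) (ht : 0 < t) (α : ℝ) (hα : α ∈ Set.Icc (0 : ℝ) 1)
    (lopt : Fin n → ℝ)
    (hfix : ∀ i, (D : ℝ) ^ (-(lopt i)) =
      α * (p i ^ (t + 1) * (D : ℝ) ^ (t * lopt i) /
          ∑ j, p j ^ (t + 1) * (D : ℝ) ^ (t * lopt j)) +
        (1 - α) * p i) :
    (∑ i, (D : ℝ) ^ (-(lopt i)) = 1) ∧
    (∀ l : Fin n → ℝ, (∀ i, 0 ≤ l i) → (∑ i, (D : ℝ) ^ (-(l i)) ≤ 1) →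
      (α / t) * Real.logb D (∑ i, p i * (D : ℝ) ^ (t * (lopt i + Real.logb D (p i)))) +
          (1 - α) * ((∑ i, p i * lopt i) - (-∑ i, p i * Real.logb D (p i))) ≤
        (α / t) * Real.logb D (∑ i, p i * (D : ℝ) ^ (t * (l i + Real.logb D (p i)))) +
          (1 - α) * ((∑ i, p i * l i) - (-∑ i, p i * Real.logb D (p i)))) := by
  have hb : (1 : ℝ) < D := by exact_mod_cast hD
  have hb0 : (0 : ℝ) < D := by linarith
  obtain ⟨hα0, hα1⟩ := hα
  have : NeZero n := ⟨by omega⟩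
  have hexp : ∀ (l : Fin n → ℝ) i, p i * (D : ℝ) ^ (t * (l i + Real.logb D (p i))) =
      p i ^ (t + 1) * (D : ℝ) ^ (t * l i) := by
    intro l i
    rw [mul_add, Real.rpow_add hb0, mul_comm t (Real.logb D (p i)), Real.rpow_mul hb0.le _ t,
      Real.rpow_logb hb0 hb.ne' (hp i), Real.rpow_add_one (hp i).ne']
    ring
  have hpos : ∀ (l : Fin n → ℝ), 0 < ∑ i, p i ^ (t + 1) * (D : ℝ) ^ (t * l i) := fun l =>
    Finset.sum_pos (fun i _ => mul_pos (Real.rpow_pos_of_pos (hp i) _)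
      (Real.rpow_pos_of_pos hb0 _)) Finset.univ_nonempty
  set S := ∑ j, p j ^ (t + 1) * (D : ℝ) ^ (t * lopt j) with hS
  have hS0 : 0 < S := hpos lopt
  set μ : Fin n → ℝ := fun i => p i ^ (t + 1) * (D : ℝ) ^ (t * lopt i) / S with hμ
  have hμ0 : ∀ i, 0 ≤ μ i := fun i => div_nonneg (mul_nonneg
    (Real.rpow_nonneg (hp i).le _) (Real.rpow_nonneg hb0.le _)) hS0.le
  have hμ1 : ∑ i, μ i = 1 := by
    rw [hμ, ← Finset.sum_div, ← hS, div_self hS0.ne']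
  have hq : ∀ i, (D : ℝ) ^ (-(lopt i)) = α * μ i + (1 - α) * p i := hfix
  have hq1 : ∑ i, (D : ℝ) ^ (-(lopt i)) = 1 := by
    simp only [hq, Finset.sum_add_distrib, ← Finset.mul_sum, hμ1, hsum]
    ring
  refine ⟨hq1, fun l _ hl => ?_⟩
  simp only [hexp]
  rw [← hS]
  have hratio : ∑ i, μ i * (D : ℝ) ^ (t * (l i - lopt i)) =
      (∑ i, p i ^ (t + 1) * (D : ℝ) ^ (t * l i)) / S := by
    rw [Finset.sum_div]
    refine Finset.sum_congr rfl fun i _ => ?_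
    rw [hμ, mul_sub, Real.rpow_sub hb0]
    have := (Real.rpow_pos_of_pos hb0 (t * lopt i)).ne'
    field_simp
  have hexpo := sum_mul_le_logb_sum_mul_rpow hb hμ0 hμ1 (fun i => t * (l i - lopt i))
  rw [hratio, Real.logb_div (hpos l).ne' hS0.ne'] at hexpo
  have hkraft := sum_mul_le_logb_sum_mul_rpow hb (fun i => Real.rpow_nonneg hb0.le _) hq1
    (fun i => -(l i - lopt i))
  have hshift : ∀ i, (D : ℝ) ^ (-(lopt i)) * (D : ℝ) ^ (-(l i - lopt i)) =
      (D : ℝ) ^ (-(l i)) := by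
    intro i
    rw [← Real.rpow_add hb0]
    ring_nf
  simp only [hshift] at hkraft
  have hlog : Real.logb D (∑ i, (D : ℝ) ^ (-(l i))) ≤ 0 :=
    Real.logb_nonpos hb (Finset.sum_nonneg fun i _ => Real.rpow_nonneg hb0.le _) hl
  have hdecomp : ∑ i, (D : ℝ) ^ (-(lopt i)) * -(l i - lopt i) =
      -(α * ∑ i, μ i * (l i - lopt i)) -
        (1 - α) * ((∑ i, p i * l i) - ∑ i, p i * lopt i) := by
    rw [← Finset.sum_sub_distrib, Finset.mul_sum, Finset.mul_sum, ← Finset.sum_neg_distrib,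
      ← Finset.sum_sub_distrib]
    refine Finset.sum_congr rfl fun i _ => ?_
    rw [hq]
    ring
  have ht' : ∑ i, μ i * (t * (l i - lopt i)) = t * ∑ i, μ i * (l i - lopt i) := by
    rw [Finset.mul_sum]
    exact Finset.sum_congr rfl fun i _ => by ring
  rw [ht'] at hexpo
  have hscaled := mul_le_mul_of_nonneg_left hexpo (div_nonneg hα0 ht.le)
  rw [← mul_assoc, div_mul_cancel₀ _ ht.ne'] at hscaled
  linarith
end
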